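/- Let ℓ ≥ 1, let V be an ℝ-linear subspace of ℝ^ℓ, and let π : ℝ^ℓ → (ℝ⧸ℤ)^ℓ be the componentwise quotient homomorphism onto the ℓ-torus. Call an ℝ-linear subspace W ⊆ ℝ^ℓ rational if W is spanned over ℝ by W ∩ ℚ^ℓ (the vectors in W all of whose coordinates are rational). Then there exists a rational subspace W with V ⊆ W such that the closure of π(V) in the torus equals π(W), and W is contained in every rational subspace containing V. In particular, π(V) is closed in the torus if and only if V is rational. -/

import Mathlib

/-- A linear subspace `W ⊆ ℝ^ℓ` is rational if it is spanned over ℝ by its vectors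
with all coordinates rational. -/
def IsRationalSubspace (ℓ : ℕ) (W : Submodule ℝ (Fin ℓ → ℝ)) : Prop :=
  Submodule.span ℝ
      ((W : Set (Fin ℓ → ℝ)) ∩ {x : Fin ℓ → ℝ | ∀ i, ∃ q : ℚ, x i = (q : ℝ)}) = W

/-- The componentwise projection `ℝ^ℓ → (ℝ⧸ℤ)^ℓ`. -/
noncomputable def torusProj (ℓ : ℕ) (x : Fin ℓ → ℝ) : Fin ℓ → AddCircle (1 : ℝ) :=
  fun i => (x i : AddCircle (1 : ℝ))

open Filter Topology Module

section ClosedSubgroups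

variable {E : Type*} [NormedAddCommGroup E] [NormedSpace ℝ E] [FiniteDimensional ℝ E]

/-- A closed, non-discrete subgroup of a finite-dimensional real vector space contains a line. -/
theorem AddSubgroup.exists_forall_smul_mem_of_not_discreteTopology (H : AddSubgroup E)
    (hH : IsClosed (H : Set E)) (hd : ¬ DiscreteTopology H) :
    ∃ v : E, v ≠ 0 ∧ ∀ t : ℝ, t • v ∈ H := by
  have small : ∀ n : ℕ, ∃ x ∈ H, x ≠ 0 ∧ ‖x‖ < 1 / ((n : ℝ) + 1) := by
    intro n
    by_contra! hn
    refine hd (discreteTopology_of_isOpen_singleton_zero ?_)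
    refine ⟨Metric.ball 0 (1 / ((n : ℝ) + 1)), Metric.isOpen_ball, ?_⟩
    ext x
    simp only [Set.mem_preimage, mem_ball_zero_iff, Set.mem_singleton_iff]
    constructor
    · intro hx
      by_contra h0
      exact absurd (hn x x.2 (by simpa using h0)) (not_le.mpr hx)
    · rintro rfl
      simpa using by positivity
  choose x hxH hx0 hxn using small
  have hpos : ∀ n, 0 < ‖x n‖ := fun n => norm_pos_iff.mpr (hx0 n)
  have hx_lim : Tendsto (fun n => ‖x n‖) atTop (𝓝 0) :=
    squeeze_zero (fun n => norm_nonneg _) (fun n => (hxn n).le)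
      tendsto_one_div_add_atTop_nhds_zero_nat
  obtain ⟨v, hv, φ, hφ, hlim⟩ := (isCompact_sphere (0 : E) 1).tendsto_subseq
    (x := fun n => ‖x n‖⁻¹ • x n) (fun n => by
      simp [norm_smul, (hpos n).ne'])
  refine ⟨v, by rintro rfl; simp at hv, fun t => ?_⟩
  have hcoef : Tendsto (fun n => (⌊t / ‖x n‖⌋ : ℝ) * ‖x n‖) atTop (𝓝 t) := by
    have hlow : Tendsto (fun n => t - ‖x n‖) atTop (𝓝 t) := by
      simpa using tendsto_const_nhds.sub hx_lim
    refine tendsto_of_tendsto_of_tendsto_of_le_of_le hlow tendsto_const_nhds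
      (fun n => ?_) (fun n => ?_)
    · have h := Int.lt_floor_add_one (t / ‖x n‖)
      rw [div_lt_iff₀ (hpos n)] at h
      simp only
      linarith
    · have h := Int.floor_le (t / ‖x n‖)
      rwa [le_div_iff₀ (hpos n)] at h
  refine hH.mem_of_tendsto ((hcoef.comp hφ.tendsto_atTop).smul hlim) (Eventually.of_forall ?_)
  intro n
  have : ((⌊t / ‖x (φ n)‖⌋ : ℝ) * ‖x (φ n)‖) • ‖x (φ n)‖⁻¹ • x (φ n)
      = ⌊t / ‖x (φ n)‖⌋ • x (φ n) := by
    rw [smul_smul, mul_assoc, mul_inv_cancel₀ (hpos _).ne', mul_one, Int.cast_smul_eq_zsmul]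
  simpa only [Function.comp_apply, this] using! H.zsmul_mem (hxH _) _

/-- If a surjective linear map sends a lattice to a discrete subgroup, then its kernel is spanned
by lattice vectors. -/
theorem LinearMap.span_ker_inter_eq_ker {F : Type*} [NormedAddCommGroup F] [NormedSpace ℝ F]
    [FiniteDimensional ℝ F] (L : Submodule ℤ E) [DiscreteTopology L] [IsZLattice ℝ L]
    (P : E →ₗ[ℝ] F) (hP : Function.Surjective P)
    (hd : DiscreteTopology (L.map (P.restrictScalars ℤ))) :
    Submodule.span ℝ ((LinearMap.ker P : Set E) ∩ L) = LinearMap.ker P := by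
  have hle : Submodule.span ℝ ((LinearMap.ker P : Set E) ∩ L) ≤ LinearMap.ker P :=
    Submodule.span_le.mpr Set.inter_subset_left
  refine Submodule.eq_of_le_of_finrank_eq hle ?_
  let K : Submodule ℤ E := L ⊓ LinearMap.ker (P.restrictScalars ℤ)
  have hK : (K : Set E) = (LinearMap.ker P : Set E) ∩ L := by
    ext; simp [K, and_comm]
  have hKd : DiscreteTopology (Submodule.span ℤ (K : Set E)) := by
    rw [Submodule.span_eq]
    exact DiscreteTopology.of_subset (s := (L : Set E)) ‹_› inf_le_left
  have h1 := Real.finrank_eq_int_finrank_of_discrete hKd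
  rw [Set.finrank, Set.finrank, Submodule.span_eq, hK] at h1
  have : IsZLattice ℝ (L.map (P.restrictScalars ℤ)) := ⟨by
    have : ((L.map (P.restrictScalars ℤ) : Submodule ℤ F) : Set F) = P '' L := rfl
    rw [this, Submodule.span_image, IsZLattice.span_top, Submodule.map_top,
      LinearMap.range_eq_top.mpr hP]⟩
  have h2 := ZLattice.rank ℝ (L.map (P.restrictScalars ℤ))
  have h3 := ZLattice.rank ℝ L
  have h4 := (LinearMap.ker ((P.restrictScalars ℤ).domRestrict L)).finrank_quotient_add_finrank
  rw [((P.restrictScalars ℤ).domRestrict L).quotKerEquivRange.finrank_eq] at h4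
  have h5 := P.finrank_range_add_finrank_ker
  rw [LinearMap.range_eq_top.mpr hP, finrank_top] at h5
  have h6 : LinearMap.range ((P.restrictScalars ℤ).domRestrict L)
      = L.map (P.restrictScalars ℤ) := LinearMap.range_domRestrict _ _
  have h7 : finrank ℤ (LinearMap.ker ((P.restrictScalars ℤ).domRestrict L)) = finrank ℤ K := by
    have : LinearMap.ker ((P.restrictScalars ℤ).domRestrict L)
        = Submodule.comap L.subtype K := by
      ext x; simp [K]
    rw [this]
    exact (Submodule.comapSubtypeEquivOfLe (inf_le_left : K ≤ L)).finrank_eq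
  rw [h6, h7] at h4
  omega

/-- The closure of the sum of a subspace and a lattice is the sum of a larger subspace, spanned by
lattice vectors, and the lattice. -/
theorem Submodule.exists_topologicalClosure_sup_lattice_eq (L : Submodule ℤ E)
    [DiscreteTopology L] [IsZLattice ℝ L] (V : Submodule ℝ E) :
    ∃ W : Submodule ℝ E, V ≤ W ∧ Submodule.span ℝ ((W : Set E) ∩ L) = W ∧
      (V.toAddSubgroup ⊔ L.toAddSubgroup).topologicalClosure
        = W.toAddSubgroup ⊔ L.toAddSubgroup := by
  set H := (V.toAddSubgroup ⊔ L.toAddSubgroup).topologicalClosure with hHdef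
  have hHc : IsClosed (H : Set E) := AddSubgroup.isClosed_topologicalClosure _
  have hleH : V.toAddSubgroup ⊔ L.toAddSubgroup ≤ H := AddSubgroup.le_topologicalClosure _
  let W : Submodule ℝ E :=
    { carrier := {x | ∀ t : ℝ, t • x ∈ H}
      add_mem' := fun hx hy t => by rw [smul_add]; exact H.add_mem (hx t) (hy t)
      zero_mem' := fun t => by rw [smul_zero]; exact H.zero_mem
      smul_mem' := fun c x hx t => by rw [smul_smul]; exact hx _ }
  have hWH : ∀ x ∈ W, x ∈ H := fun x hx => by simpa using hx 1
  have hVW : V ≤ W := fun x hx t =>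
    hleH (AddSubgroup.mem_sup_left (show t • x ∈ V from V.smul_mem t hx))
  obtain ⟨C, hWC⟩ := W.exists_isCompl
  let P : E →ₗ[ℝ] C := C.projectionOnto W hWC.symm
  have hP : Function.Surjective P := Submodule.projectionOnto_surjective _
  have hker : LinearMap.ker P = W := Submodule.ker_projectionOnto _
  have hPid : ∀ c : C, P c = c := Submodule.projectionOnto_apply_left _
  have hPc : Continuous P := P.continuous_of_finiteDimensional
  have hsub : ∀ x : E, x - P x ∈ W := fun x => by
    rw [← hker, LinearMap.mem_ker, map_sub, hPid, sub_self]
  let H' : AddSubgroup C := H.comap C.subtype.toAddMonoidHom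
  have hH'd : DiscreteTopology H' := by
    by_contra hd
    obtain ⟨v, hv0, hv⟩ := H'.exists_forall_smul_mem_of_not_discreteTopology
      (hHc.preimage continuous_subtype_val) hd
    refine hv0 (Subtype.ext ?_)
    have hvW : (v : E) ∈ W := fun t => hv t
    exact Submodule.disjoint_def.mp hWC.disjoint _ hvW v.2
  have hML : ∀ y ∈ L.map (P.restrictScalars ℤ), y ∈ H' := by
    rintro _ ⟨x, hx, rfl⟩
    have h : x - (x - P x) ∈ H :=
      H.sub_mem (hleH (AddSubgroup.mem_sup_right hx)) (hWH _ (hsub x))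
    rwa [sub_sub_cancel] at h
  have hMd : DiscreteTopology (L.map (P.restrictScalars ℤ)) :=
    DiscreteTopology.of_subset (s := (H' : Set C)) hH'd hML
  have hMc : IsClosed ((L.map (P.restrictScalars ℤ)).toAddSubgroup : Set C) := by
    have : DiscreteTopology (L.map (P.restrictScalars ℤ)).toAddSubgroup := hMd
    exact AddSubgroup.isClosed_of_discrete
  refine ⟨W, hVW, ?_, le_antisymm ?_ ?_⟩
  · have h := P.span_ker_inter_eq_ker L hP hMd
    rwa [hker] at h
  · have h : H ≤ (L.map (P.restrictScalars ℤ)).toAddSubgroup.comap P.toAddMonoidHom := by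
      refine AddSubgroup.topologicalClosure_minimal _ (sup_le ?_ ?_) (hMc.preimage hPc)
      · intro x hx
        have : P x = 0 := by rw [← LinearMap.mem_ker, hker]; exact hVW hx
        exact ⟨0, L.zero_mem, by simp [this]⟩
      · intro x hx
        exact ⟨x, hx, rfl⟩
    intro x hx
    obtain ⟨y, hy, hyx⟩ := h hx
    have hxy : x - y ∈ W := by
      rw [← hker, LinearMap.mem_ker, map_sub, sub_eq_zero]
      exact hyx.symm
    exact AddSubgroup.mem_sup.mpr ⟨x - y, hxy, y, hy, sub_add_cancel _ _⟩
  · exact sup_le hWH (le_sup_right.trans hleH)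

/-- A subspace contained in the sum of a subspace and a lattice is contained in the former. -/
theorem Submodule.le_of_toAddSubgroup_le_sup_lattice (L : Submodule ℤ E) [DiscreteTopology L]
    [IsZLattice ℝ L] {V W : Submodule ℝ E} (h : W.toAddSubgroup ≤ V.toAddSubgroup ⊔ L.toAddSubgroup) :
    W ≤ V := by
  intro w hw
  have hmem : ∀ t : ℝ, ∃ z : L, t • w - z ∈ V := fun t => by
    obtain ⟨v, hv, z, hz, hvz⟩ :=
      AddSubgroup.mem_sup.mp (h (show t • w ∈ W from W.smul_mem t hw))
    exact ⟨⟨z, hz⟩, by rw [← hvz, add_sub_cancel_right]; exact hv⟩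
  choose z hz using hmem
  obtain ⟨s, t, hst, hne⟩ : ∃ s t : ℝ, z s = z t ∧ s ≠ t := by
    by_contra! hinj
    exact not_countable (Function.Injective.countable (f := z) fun s t => hinj s t)
  have hV : (s - t) • w ∈ V := by
    have := V.sub_mem (hz s) (hz t)
    rwa [hst, sub_sub_sub_cancel_right, ← sub_smul] at this
  exact (V.smul_mem_iff (sub_ne_zero.mpr hne)).mp hV

end ClosedSubgroups

section Torus

variable {ℓ : ℕ}

/-- The lattice `ℤ^ℓ` in `ℝ^ℓ`. -/
abbrev integerLattice (ℓ : ℕ) : Submodule ℤ (Fin ℓ → ℝ) :=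
  Submodule.span ℤ (Set.range (Pi.basisFun ℝ (Fin ℓ)))

theorem mem_integerLattice {x : Fin ℓ → ℝ} :
    x ∈ integerLattice ℓ ↔ ∀ i, ∃ n : ℤ, (n : ℝ) = x i := by
  simp [integerLattice, Basis.mem_span_iff_repr_mem]

theorem continuous_torusProj : Continuous (torusProj ℓ) :=
  continuous_pi fun i => (AddCircle.continuous_mk' 1).comp (continuous_apply i)

theorem torusProj_eq_iff {x y : Fin ℓ → ℝ} :
    torusProj ℓ x = torusProj ℓ y ↔ x - y ∈ integerLattice ℓ := by
  rw [mem_integerLattice, funext_iff]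
  refine forall_congr' fun i => ?_
  rw [torusProj, torusProj, ← sub_eq_zero, ← AddCircle.coe_sub, AddCircle.coe_eq_zero_iff]
  simp

theorem torusProj_mem_image_iff {V : Submodule ℝ (Fin ℓ → ℝ)} {x : Fin ℓ → ℝ} :
    torusProj ℓ x ∈ torusProj ℓ '' (V : Set (Fin ℓ → ℝ)) ↔
      x ∈ V.toAddSubgroup ⊔ (integerLattice ℓ).toAddSubgroup := by
  rw [AddSubgroup.mem_sup]
  constructor
  · rintro ⟨v, hv, h⟩
    exact ⟨v, hv, x - v, torusProj_eq_iff.mp h.symm, add_sub_cancel _ _⟩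
  · rintro ⟨v, hv, z, hz, rfl⟩
    refine ⟨v, hv, (torusProj_eq_iff.mpr ?_).symm⟩
    rwa [add_sub_cancel_left]

/-- A subspace is rational iff it is spanned by its integral vectors. -/
theorem isRationalSubspace_iff {W : Submodule ℝ (Fin ℓ → ℝ)} :
    IsRationalSubspace ℓ W ↔
      Submodule.span ℝ ((W : Set (Fin ℓ → ℝ)) ∩ integerLattice ℓ) = W := by
  suffices h : Submodule.span ℝ ((W : Set (Fin ℓ → ℝ)) ∩ integerLattice ℓ) =
      Submodule.span ℝ
        ((W : Set (Fin ℓ → ℝ)) ∩ {x : Fin ℓ → ℝ | ∀ i, ∃ q : ℚ, x i = (q : ℝ)}) by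
    rw [h, IsRationalSubspace]
  apply le_antisymm
  · refine Submodule.span_mono (Set.inter_subset_inter_right _ fun x hx i => ?_)
    obtain ⟨n, hn⟩ := mem_integerLattice.mp hx i
    exact ⟨n, by simp [hn]⟩
  · rw [Submodule.span_le]
    rintro x ⟨hxW, hxq⟩
    choose q hq using hxq
    let d : ℕ := ∏ i, (q i).den
    have hd : (d : ℝ) ≠ 0 :=
      Nat.cast_ne_zero.mpr (Finset.prod_ne_zero_iff.mpr fun i _ => (q i).den_nz)
    refine (Submodule.smul_mem_iff _ hd).mp (Submodule.subset_span ⟨W.smul_mem _ hxW, ?_⟩)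
    refine mem_integerLattice.mpr fun i => ?_
    obtain ⟨k, hk⟩ : (q i).den ∣ d := Finset.dvd_prod_of_mem _ (Finset.mem_univ i)
    refine ⟨k * (q i).num, ?_⟩
    have hnum : ((q i).den : ℝ) * (q i : ℝ) = (q i).num := by
      exact_mod_cast Rat.den_mul_eq_num (q i)
    rw [Pi.smul_apply, smul_eq_mul, hq, hk]
    push_cast
    rw [← hnum]
    ring

theorem IsRationalSubspace.isClosed_image {W : Submodule ℝ (Fin ℓ → ℝ)}
    (hW : IsRationalSubspace ℓ W) : IsClosed (torusProj ℓ '' (W : Set (Fin ℓ → ℝ))) := by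
  rw [isRationalSubspace_iff] at hW
  let L : Submodule ℤ W := (integerLattice ℓ).comap (W.subtype.restrictScalars ℤ)
  have hd : DiscreteTopology (integerLattice ℓ) := inferInstance
  have : DiscreteTopology L :=
    hd.preimage_of_continuous_injective (integerLattice ℓ : Set (Fin ℓ → ℝ)) continuous_subtype_val W.injective_subtype
  have himg : W.subtype '' (L : Set W) = (W : Set (Fin ℓ → ℝ)) ∩ integerLattice ℓ := by
    ext x
    simp [L, and_comm]
  have : IsZLattice ℝ L := ⟨by
    rw [← (Submodule.map_injective_of_injective W.injective_subtype).eq_iff, Submodule.map_span,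
      himg, hW, Submodule.map_top, Submodule.range_subtype]⟩
  have hc := IsZLattice.isCompact_range_of_periodic L (fun w : W => torusProj ℓ w)
    (continuous_torusProj.comp continuous_subtype_val) (fun z w hw => by
      rw [torusProj_eq_iff, Submodule.coe_add, add_sub_cancel_left]
      exact hw)
  rw [Set.image_eq_range]
  exact hc.isClosed

end Torus

/-- the closure of the image of a linear subspace `V ⊆ ℝ^ℓ` in the torus
`(ℝ⧸ℤ)^ℓ` is the image of the smallest rational subspace containing `V`; in particular
the image is closed iff `V` is rational. -/
theorem stmt_19 (ℓ : ℕ) (hℓ : 1 ≤ ℓ) (V : Submodule ℝ (Fin ℓ → ℝ)) :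
    (∃ W : Submodule ℝ (Fin ℓ → ℝ), IsRationalSubspace ℓ W ∧ V ≤ W ∧
      closure (torusProj ℓ '' (V : Set (Fin ℓ → ℝ))) =
        torusProj ℓ '' (W : Set (Fin ℓ → ℝ)) ∧
      ∀ W' : Submodule ℝ (Fin ℓ → ℝ),
        IsRationalSubspace ℓ W' → V ≤ W' → W ≤ W') ∧
    (IsClosed (torusProj ℓ '' (V : Set (Fin ℓ → ℝ))) ↔ IsRationalSubspace ℓ V) := by
  obtain ⟨W, hVW, hspan, hcl⟩ :=
    Submodule.exists_topologicalClosure_sup_lattice_eq (integerLattice ℓ) V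
  have hW : IsRationalSubspace ℓ W := isRationalSubspace_iff.mpr hspan
  have hclosure : closure (torusProj ℓ '' (V : Set (Fin ℓ → ℝ))) =
      torusProj ℓ '' (W : Set (Fin ℓ → ℝ)) := by
    refine (closure_minimal (Set.image_mono hVW) hW.isClosed_image).antisymm ?_
    rintro _ ⟨w, hw, rfl⟩
    have hw' : w ∈ (V.toAddSubgroup ⊔ (integerLattice ℓ).toAddSubgroup).topologicalClosure :=
      hcl ▸ AddSubgroup.mem_sup_left hw
    exact map_mem_closure continuous_torusProj hw' fun x hx => torusProj_mem_image_iff.mpr hx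
  have hmin : ∀ W' : Submodule ℝ (Fin ℓ → ℝ),
      IsClosed (torusProj ℓ '' (W' : Set (Fin ℓ → ℝ))) → V ≤ W' → W ≤ W' := by
    intro W' hW' hVW'
    refine Submodule.le_of_toAddSubgroup_le_sup_lattice (integerLattice ℓ) fun w hw => ?_
    refine torusProj_mem_image_iff.mp (closure_minimal (Set.image_mono hVW') hW' ?_)
    rw [hclosure]
    exact ⟨w, hw, rfl⟩
  refine ⟨⟨W, hW, hVW, hclosure, fun W' hW' => hmin W' hW'.isClosed_image⟩, fun hV => ?_,
    fun hV => hV.isClosed_image⟩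
  rwa [hVW.antisymm (hmin V hV le_rfl)]
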